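/- Let n ≥ 2, let x ∈ ℂⁿ have all coordinates nonzero, and let 1 ≤ d ≤ n−1. Then f_d(x^{−1}) · (x_0 x_1 ⋯ x_{n−1}) = f_{n−d}(x), where x^{−1} denotes the point with coordinates (x^{−1})_i = x_i^{−1}. -/

import Mathlib

/-- The `d`-th polynomial of the cyclic `n`-roots system evaluated at `x`
(only the coordinates `x 0, …, x (n-1)` are used):
`f_d(x) = Σ_{i=0}^{n-1} Π_{j=0}^{d-1} x_{(i+j) mod n}`. -/
noncomputable def cyclicF (n d : ℕ) (x : ℕ → ℂ) : ℂ :=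
  ∑ i ∈ Finset.range n, ∏ j ∈ Finset.range d, x ((i + j) % n)

/-- `x` is a cyclic `n`-root: `f_d(x) = 0` for `d = 1, …, n-1` and
`x_0 x_1 ⋯ x_{n-1} = 1`. -/
def IsCyclicRoot (n : ℕ) (x : ℕ → ℂ) : Prop :=
  (∀ d : ℕ, 1 ≤ d → d ≤ n - 1 → cyclicF n d x = 0) ∧
  ∏ i ∈ Finset.range n, x i = 1

/-- The product of an `n`-periodic function over a window of `n` consecutive integers does not
depend on where the window starts. -/
@[to_additive]
theorem Function.Periodic.prod_range_add {M : Type*} [CommMonoid M] {n : ℕ} {g : ℕ → M}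
    (hg : Function.Periodic g n) (k : ℕ) :
    ∏ i ∈ Finset.range n, g (i + k) = ∏ i ∈ Finset.range n, g i := by
  induction k with
  | zero => rfl
  | succ k ih =>
    rw [← ih]
    cases n with
    | zero => rfl
    | succ m =>
      rw [Finset.prod_range_succ, Finset.prod_range_succ']
      congr 1
      · exact Finset.prod_congr rfl fun i _ => congrArg g (by ring)
      · rw [← hg (0 + k)]
        exact congrArg g (by ring)

/-- For `x ∈ ℂⁿ` with all coordinates nonzero and `1 ≤ d ≤ n-1`,
`f_d(x⁻¹) · (x_0 x_1 ⋯ x_{n-1}) = f_{n-d}(x)`. -/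
theorem cyclicF_inv_mul_prod
    (n : ℕ) (hn : 2 ≤ n) (x : ℕ → ℂ) (hx : ∀ i < n, x i ≠ 0)
    (d : ℕ) (hd1 : 1 ≤ d) (hd2 : d ≤ n - 1) :
    cyclicF n d (fun i => (x i)⁻¹) * ∏ i ∈ Finset.range n, x i
      = cyclicF n (n - d) x := by
  have hdn : d ≤ n := by omega
  have hper : Function.Periodic (fun i => x (i % n)) n := fun i => by simp
  have hprod : ∀ i, ∏ j ∈ Finset.range n, x ((i + j) % n) = ∏ j ∈ Finset.range n, x j := fun i => by
    simp_rw [add_comm i]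
    rw [hper.prod_range_add i]
    exact Finset.prod_congr rfl fun j hj => by rw [Nat.mod_eq_of_lt (Finset.mem_range.mp hj)]
  have hwin : Function.Periodic (fun i => ∏ j ∈ Finset.range (n - d), x ((i + j) % n)) n :=
    fun i => by simp [add_right_comm i n]
  unfold cyclicF
  rw [← hwin.sum_range_add d, Finset.sum_mul]
  refine Finset.sum_congr rfl fun i _ => ?_
  have hne : ∏ j ∈ Finset.range d, x ((i + j) % n) ≠ 0 :=
    Finset.prod_ne_zero_iff.mpr fun j _ => hx _ (Nat.mod_lt _ (by omega))
  rw [← hprod i, ← Finset.prod_range_mul_prod_Ico _ hdn, Finset.prod_Ico_eq_prod_range,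
    Finset.prod_inv_distrib, inv_mul_cancel_left₀ hne]
  simp only [add_assoc]
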